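/- arXiv:1709.04851 — 5 statements merged into one kernel-verified Lean document; each statement's English description precedes it below -/
import Mathlib

section
/- Let n ≥ 1 and for each i = 1,…,n let l_i, u_i, m_i be real numbers, and set Ȳ = (1/(3n))·Σ_{i=1}^n (l_i+u_i+m_i). Then (1/(6n))·Σ_{i=1}^n [(l_i−Ȳ)² + (u_i−Ȳ)² + (m_i−Ȳ)² + (l_i−Ȳ)(u_i−Ȳ) + (l_i−Ȳ)(m_i−Ȳ) + (u_i−Ȳ)(m_i−Ȳ)] = (1/(6n))·Σ_{i=1}^n (l_i²+u_i²+m_i²+l_iu_i+l_im_i+u_im_i) − Ȳ²; i.e., the Covariance 2 of an interval-valued variable with itself under the Triangular distribution coincides with its symbolic sample variance. -/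
theorem triangular_cov2_equals_variance (n : ℕ) (hn : 1 ≤ n) (l u m : Fin n → ℝ)
    (Ybar : ℝ) (hY : Ybar = (1 / (3 * (n : ℝ))) * ∑ i, (l i + u i + m i)) :
    (1 / (6 * (n : ℝ))) *
        (∑ i, ((l i - Ybar) ^ 2 + (u i - Ybar) ^ 2 + (m i - Ybar) ^ 2 +
          (l i - Ybar) * (u i - Ybar) + (l i - Ybar) * (m i - Ybar) +
          (u i - Ybar) * (m i - Ybar))) =
      (1 / (6 * (n : ℝ))) *
          (∑ i, (l i ^ 2 + u i ^ 2 + m i ^ 2 + l i * u i + l i * m i + u i * m i)) -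
        Ybar ^ 2 := by
  have hn0 : (n : ℝ) ≠ 0 := by
    have : n ≠ 0 := by omega
    exact_mod_cast this
  have hS : ∑ i, (l i + u i + m i) = 3 * (n : ℝ) * Ybar := by
    rw [hY]; field_simp
  have hQ : (∑ i, ((l i - Ybar) ^ 2 + (u i - Ybar) ^ 2 + (m i - Ybar) ^ 2 +
          (l i - Ybar) * (u i - Ybar) + (l i - Ybar) * (m i - Ybar) +
          (u i - Ybar) * (m i - Ybar))) =
      (∑ i, (l i ^ 2 + u i ^ 2 + m i ^ 2 + l i * u i + l i * m i + u i * m i))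
        - 4 * Ybar * (∑ i, (l i + u i + m i)) + ∑ _i : Fin n, 6 * Ybar ^ 2 := by
    rw [Finset.mul_sum, ← Finset.sum_sub_distrib, ← Finset.sum_add_distrib]
    refine Finset.sum_congr rfl fun i _ => ?_
    ring
  rw [hQ, hS, Finset.sum_const, Finset.card_univ, Fintype.card_fin, nsmul_eq_mul]
  field_simp
  ring
end

section
/- Let n ≥ 1, for each i = 1,…,n let l_i < u_i be real numbers, let f_i be the Symmetric Triangular density on [l_i,u_i], let f = (1/n)·Σ_{i=1}^n f_i be the equal-weight mixture density, and set Ȳ = (1/(2n))·Σ_{i=1}^n (l_i+u_i). Then the variance of the mixture, ∫ x²·f(x) dx − Ȳ², equals (1/(24n))·Σ_{i=1}^n (7l_i²+10l_iu_i+7u_i²) − Ȳ². -/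
open MeasureTheory Real

/-- The Triangular density on `[l,u]` with mode `m`. -/
noncomputable def triDensity (l u m : ℝ) (x : ℝ) : ℝ :=
  if l ≤ x ∧ x ≤ m then 2 * (x - l) / ((u - l) * (m - l))
  else if m < x ∧ x ≤ u then 2 * (u - x) / ((u - l) * (u - m))
  else 0

/-- The Symmetric Triangular density on `[l,u]`: the Triangular density with mode `(l+u)/2`. -/
noncomputable def symTriDensity (l u : ℝ) (x : ℝ) : ℝ :=
  triDensity l u ((l + u) / 2) x

theorem aux_fun (l u : ℝ) (h : l < u) :
    (fun x : ℝ => x ^ 2 * symTriDensity l u x) =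
      (Set.Ioc l ((l + u) / 2)).indicator (fun x => 4 / (u - l) ^ 2 * (x ^ 3 - l * x ^ 2)) +
      (Set.Ioc ((l + u) / 2) u).indicator (fun x => 4 / (u - l) ^ 2 * (u * x ^ 2 - x ^ 3)) := by
  have h0 : u - l ≠ 0 := by linarith
  have e1 : (l + u) / 2 - l = (u - l) / 2 := by ring
  have e2 : u - (l + u) / 2 = (u - l) / 2 := by ring
  funext x
  simp only [symTriDensity, triDensity, Pi.add_apply, Set.indicator_apply, Set.mem_Ioc, e1, e2]
  by_cases c1 : x ≤ (l + u) / 2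
  · rcases lt_trichotomy l x with c2 | c2 | c2
    · rw [if_pos ⟨c2.le, c1⟩, if_pos ⟨c2, c1⟩, if_neg (fun h => absurd h.1 (not_lt.2 c1))]
      field_simp
      ring
    · subst c2
      rw [if_pos ⟨le_refl _, c1⟩, if_neg (fun h => lt_irrefl _ h.1),
        if_neg (fun h => absurd h.1 (not_lt.2 c1))]
      simp
    · simp [not_le.2 c2, not_lt.2 c2.le, not_lt.2 c1]
  · have c4 := not_le.1 c1
    by_cases c3 : x ≤ u
    · simp only [c1, c3, c4, and_false, and_true, if_true, if_false]
      field_simp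
      ring
    · simp [c1, c3]

theorem aux_ind (a b : ℝ) (hab : a ≤ b) (f F : ℝ → ℝ) (hf : Continuous f)
    (hF : ∀ x, HasDerivAt F (f x) x) :
    Integrable ((Set.Ioc a b).indicator f) ∧
      ∫ x, (Set.Ioc a b).indicator f x = F b - F a := by
  constructor
  · rw [integrable_indicator_iff measurableSet_Ioc]
    exact (hf.integrableOn_Icc).mono_set Set.Ioc_subset_Icc_self
  · rw [integral_indicator measurableSet_Ioc, ← intervalIntegral.integral_of_le hab]
    exact intervalIntegral.integral_eq_sub_of_hasDerivAt (fun x _ => hF x)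
      (hf.intervalIntegrable _ _)

theorem aux_deriv (c p q x : ℝ) :
    HasDerivAt (fun x : ℝ => c * (p * (x ^ 4 / 4) + q * (x ^ 3 / 3)))
      (c * (p * x ^ 3 + q * x ^ 2)) x := by
  have h4 := ((hasDerivAt_pow 4 x).div_const 4).const_mul p
  have h3 := ((hasDerivAt_pow 3 x).div_const 3).const_mul q
  refine ((h4.add h3).const_mul c).congr_deriv ?_
  norm_num

theorem aux_main (l u : ℝ) (h : l < u) :
    Integrable (fun x : ℝ => x ^ 2 * symTriDensity l u x) ∧
      ∫ x : ℝ, x ^ 2 * symTriDensity l u x = (7 * l ^ 2 + 10 * l * u + 7 * u ^ 2) / 24 := by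
  have h0 : u - l ≠ 0 := by linarith
  obtain ⟨i1, v1⟩ := aux_ind l ((l + u) / 2) (by linarith)
    (fun x => 4 / (u - l) ^ 2 * (x ^ 3 - l * x ^ 2)) _ (by fun_prop)
    (fun x => (aux_deriv (4 / (u - l) ^ 2) 1 (-l) x).congr_deriv (by ring))
  obtain ⟨i2, v2⟩ := aux_ind ((l + u) / 2) u (by linarith)
    (fun x => 4 / (u - l) ^ 2 * (u * x ^ 2 - x ^ 3)) _ (by fun_prop)
    (fun x => (aux_deriv (4 / (u - l) ^ 2) (-1) u x).congr_deriv (by ring))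
  rw [aux_fun l u h]
  refine ⟨i1.add i2, ?_⟩
  rw [integral_add' i1 i2, v1, v2]
  field_simp
  ring

theorem symmetric_triangular_mixture_variance (n : ℕ) (hn : 1 ≤ n) (l u : Fin n → ℝ)
    (hlu : ∀ i, l i < u i)
    (Ybar : ℝ) (hY : Ybar = (1 / (2 * (n : ℝ))) * ∑ i, (l i + u i)) :
    (∫ x : ℝ, x ^ 2 * ((1 / (n : ℝ)) * ∑ i, symTriDensity (l i) (u i) x)) - Ybar ^ 2 =
      (1 / (24 * (n : ℝ))) *
          (∑ i, (7 * l i ^ 2 + 10 * l i * u i + 7 * u i ^ 2)) - Ybar ^ 2 := by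
  congr 1
  have e : ∀ x : ℝ, x ^ 2 * ((1 / (n : ℝ)) * ∑ i, symTriDensity (l i) (u i) x) =
      (1 / (n : ℝ)) * ∑ i, x ^ 2 * symTriDensity (l i) (u i) x := by
    intro x
    rw [← Finset.mul_sum]
    ring
  simp_rw [e]
  rw [integral_const_mul, integral_finsetSum _ (fun i _ => (aux_main (l i) (u i) (hlu i)).1),
    Finset.sum_congr rfl (fun i _ => (aux_main (l i) (u i) (hlu i)).2), ← Finset.sum_div]
  ring
end

section
/- Let c₁, c₂ be real numbers, r₁, r₂ > 0, and m₁, m₂ real numbers with c_k − r_k ≤ m_k ≤ c_k + r_k for k = 1,2, and assume (m₁−c₁)/(2r₁) ≤ (m₂−c₂)/(2r₂). Let Ψ_k⁻¹ be the Triangular quantile function with center c_k, half-range r_k and mode m_k. Then ∫₀¹ (Ψ₁⁻¹(t) − Ψ₂⁻¹(t))² dt = (c₁−c₂)² + (1/6)(r₁−r₂)² + (1/6)(m₁−c₁)² + (1/6)(m₂−c₂)² − (5/3)r₁r₂ + (2/3)(m₁−c₁)(c₁−c₂+r₂) − (2/3)(m₂−c₂)(c₁−c₂+r₁) + (1/6)·√(r₁r₂(m₁−c₁+r₁)(m₂−c₂+r₂))·(5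 − (m₁−c₁)/r₁) + (1/6)·√(r₁r₂(c₁+r₁−m₁)(c₂+r₂−m₂))·(5 + (m₂−c₂)/r₂) + (1/2)·√(r₁r₂(c₁+r₁−m₁)(m₂−c₂+r₂))·(arcsin((m₂−c₂)/r₂) − arcsin((m₁−c₁)/r₁)). -/
open MeasureTheory Real

/-- The Triangular quantile function of the interval with center `c`, half-range `r`
and mode `m`. -/
noncomputable def triQuantileCR (c r m : ℝ) (t : ℝ) : ℝ :=
  if t ≤ (m - c) / (2 * r) + 1 / 2 then c - r + Real.sqrt (2 * r * (m - c + r) * t)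
  else c + r - Real.sqrt (2 * r * (c + r - m) * (1 - t))

/-- Antiderivative of the squared square-root combination. -/
noncomputable def triF (A P Q t : ℝ) : ℝ :=
  A ^ 2 * t + P ^ 2 * t ^ 2 / 2 + Q ^ 2 * (t - t ^ 2 / 2) + (4 / 3) * A * P * (t * √t)
    - (4 / 3) * A * Q * ((1 - t) * √(1 - t))
    + 2 * P * Q * ((1 / 4) * (2 * t - 1) * (√t * √(1 - t)) + (1 / 8) * Real.arcsin (2 * t - 1))

lemma triF_integral (A P Q a b : ℝ) (ha : 0 ≤ a) (hab : a ≤ b) (hb : b ≤ 1) :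
    ∫ t in a..b, (A + P * √t + Q * √(1 - t)) ^ 2 = triF A P Q b - triF A P Q a := by
  apply intervalIntegral.integral_eq_sub_of_hasDerivAt_of_le hab
  · apply Continuous.continuousOn
    unfold triF
    have := Real.continuous_arcsin
    fun_prop
  · intro t ht
    have h0 : 0 < t := lt_of_le_of_lt ha ht.1
    have h1 : 0 < 1 - t := by linarith [ht.2]
    have s0 : 0 < √t := Real.sqrt_pos.2 h0
    have s1 : 0 < √(1 - t) := Real.sqrt_pos.2 h1
    have e0 : √t ^ 2 = t := Real.sq_sqrt h0.le
    have e1 : √(1 - t) ^ 2 = 1 - t := Real.sq_sqrt h1.le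
    have d0 : HasDerivAt (fun t : ℝ => √t) (1 / (2 * √t)) t := Real.hasDerivAt_sqrt h0.ne'
    have dl : HasDerivAt (fun t : ℝ => 1 - t) (-1) t := by
      simpa using (hasDerivAt_id t).const_sub 1
    have d1 : HasDerivAt (fun t : ℝ => √(1 - t)) (-1 / (2 * √(1 - t))) t := dl.sqrt h1.ne'
    have dm : HasDerivAt (fun t : ℝ => 2 * t - 1) 2 t := by
      simpa using ((hasDerivAt_id t).const_mul 2).sub_const 1
    have dA : HasDerivAt (fun t : ℝ => Real.arcsin (2 * t - 1))
        (1 / (√t * √(1 - t))) t := by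
      have h := (Real.hasDerivAt_arcsin (x := 2 * t - 1) (by linarith) (by linarith)).comp t dm
      have e : √(1 - (2 * t - 1) ^ 2) = 2 * (√t * √(1 - t)) := by
        rw [Real.sqrt_eq_iff_mul_self_eq_of_pos (by positivity)]
        linear_combination 4 * √(1 - t) ^ 2 * e0 + 4 * t * e1
      rw [e] at h
      refine h.congr_deriv ?_
      field_simp
    have di := hasDerivAt_id t
    have D := (((((di.const_mul (A ^ 2)).add (((di.pow 2).const_mul (P ^ 2)).div_const 2)).add
      ((di.sub ((di.pow 2).div_const 2)).const_mul (Q ^ 2))).add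
      ((di.mul d0).const_mul ((4 / 3) * A * P))).sub
      ((dl.mul d1).const_mul ((4 / 3) * A * Q))).add
      ((((dm.const_mul (1 / 4)).mul (d0.mul d1)).add (dA.const_mul (1 / 8))).const_mul (2 * P * Q))
    refine (D.congr_deriv ?_).congr_of_eventuallyEq ?_
    · simp only [id, Pi.mul_apply]
      generalize √(1 - t) = y at *
      generalize √t = x at *
      obtain rfl : t = x ^ 2 := e0.symm
      have : y ≠ 0 := s1.ne'
      have : x ≠ 0 := s0.ne'
      field_simp
      grind
    · refine Filter.Eventually.of_forall fun s => ?_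
      simp [triF]
  · apply Continuous.intervalIntegrable
    fun_prop

lemma tri_left (c r u t : ℝ) (hr : 0 < r) (hu : 0 ≤ u) (h : t ≤ u ^ 2) :
    triQuantileCR c r (c + r * (2 * u ^ 2 - 1)) t = c - r + 2 * r * u * √t := by
  have e : (c + r * (2 * u ^ 2 - 1) - c) / (2 * r) + 1 / 2 = u ^ 2 := by field_simp; ring
  rw [triQuantileCR, e, if_pos h]
  have : 2 * r * (c + r * (2 * u ^ 2 - 1) - c + r) * t = (2 * r * u) ^ 2 * t := by ring
  rw [this, Real.sqrt_mul (by positivity), Real.sqrt_sq (by positivity)]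

lemma tri_right (c r u v t : ℝ) (hr : 0 < r) (hu : 0 ≤ u) (hv : 0 ≤ v) (huv : v ^ 2 = 1 - u ^ 2)
    (h : u ^ 2 ≤ t) :
    triQuantileCR c r (c + r * (2 * u ^ 2 - 1)) t = c + r - 2 * r * v * √(1 - t) := by
  rcases h.eq_or_lt with h | h
  · rw [tri_left _ _ _ _ hr hu h.symm.le, ← h, ← huv, Real.sqrt_sq hu, Real.sqrt_sq hv]
    linear_combination 2 * r * huv
  have e : (c + r * (2 * u ^ 2 - 1) - c) / (2 * r) + 1 / 2 = u ^ 2 := by field_simp; ring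
  rw [triQuantileCR, e, if_neg h.not_ge]
  have : 2 * r * (c + r - (c + r * (2 * u ^ 2 - 1))) * (1 - t) = (2 * r * v) ^ 2 * (1 - t) := by
    linear_combination (-4) * r ^ 2 * (1 - t) * huv
  rw [this, Real.sqrt_mul (by positivity), Real.sqrt_sq (by positivity)]

lemma tri_param (c r m : ℝ) (hr : 0 < r) (hl : c - r ≤ m) (hu : m ≤ c + r) :
    ∃ u v : ℝ, 0 ≤ u ∧ 0 ≤ v ∧ v ^ 2 = 1 - u ^ 2 ∧ m = c + r * (2 * u ^ 2 - 1) := by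
  have h0 : 0 ≤ (m - c + r) / (2 * r) := div_nonneg (by linarith) (by linarith)
  have h1 : 0 ≤ (c + r - m) / (2 * r) := div_nonneg (by linarith) (by linarith)
  refine ⟨√((m - c + r) / (2 * r)), √((c + r - m) / (2 * r)), Real.sqrt_nonneg _,
    Real.sqrt_nonneg _, ?_, ?_⟩
  · rw [Real.sq_sqrt h0, Real.sq_sqrt h1]; field_simp; ring
  · rw [Real.sq_sqrt h0]; field_simp; ring

theorem mallows_triangular_case1 (c₁ c₂ r₁ r₂ m₁ m₂ : ℝ)
    (hr₁ : 0 < r₁) (hr₂ : 0 < r₂)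
    (hm₁l : c₁ - r₁ ≤ m₁) (hm₁u : m₁ ≤ c₁ + r₁)
    (hm₂l : c₂ - r₂ ≤ m₂) (hm₂u : m₂ ≤ c₂ + r₂)
    (hord : (m₁ - c₁) / (2 * r₁) ≤ (m₂ - c₂) / (2 * r₂)) :
    ∫ t in (0 : ℝ)..1, (triQuantileCR c₁ r₁ m₁ t - triQuantileCR c₂ r₂ m₂ t) ^ 2 =
      (c₁ - c₂) ^ 2 + (1 / 6) * (r₁ - r₂) ^ 2 + (1 / 6) * (m₁ - c₁) ^ 2 +
        (1 / 6) * (m₂ - c₂) ^ 2 - (5 / 3) * r₁ * r₂ +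
        (2 / 3) * (m₁ - c₁) * (c₁ - c₂ + r₂) - (2 / 3) * (m₂ - c₂) * (c₁ - c₂ + r₁) +
        (1 / 6) * Real.sqrt (r₁ * r₂ * (m₁ - c₁ + r₁) * (m₂ - c₂ + r₂)) *
          (5 - (m₁ - c₁) / r₁) +
        (1 / 6) * Real.sqrt (r₁ * r₂ * (c₁ + r₁ - m₁) * (c₂ + r₂ - m₂)) *
          (5 + (m₂ - c₂) / r₂) +
        (1 / 2) * Real.sqrt (r₁ * r₂ * (c₁ + r₁ - m₁) * (m₂ - c₂ + r₂)) *
          (Real.arcsin ((m₂ - c₂) / r₂) - Real.arcsin ((m₁ - c₁) / r₁)) := by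
  obtain ⟨u, v, hu, hv, huv, rfl⟩ := tri_param c₁ r₁ m₁ hr₁ hm₁l hm₁u
  obtain ⟨x, y, hx, hy, hxy, rfl⟩ := tri_param c₂ r₂ m₂ hr₂ hm₂l hm₂u
  have q₁ : (c₁ + r₁ * (2 * u ^ 2 - 1) - c₁) / r₁ = 2 * u ^ 2 - 1 := by field_simp; ring
  have q₂ : (c₂ + r₂ * (2 * x ^ 2 - 1) - c₂) / r₂ = 2 * x ^ 2 - 1 := by field_simp; ring
  have hux : u ^ 2 ≤ x ^ 2 := by
    rw [mul_comm 2 r₁, mul_comm 2 r₂, ← div_div, ← div_div, q₁, q₂] at hord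
    linarith
  rw [q₁, q₂]
  have hx1 : x ^ 2 ≤ 1 := by nlinarith
  have hu1 : u ^ 2 ≤ 1 := by nlinarith
  have S1 : √(r₁ * r₂ * (c₁ + r₁ * (2 * u ^ 2 - 1) - c₁ + r₁) *
      (c₂ + r₂ * (2 * x ^ 2 - 1) - c₂ + r₂)) = 2 * r₁ * r₂ * u * x := by
    rw [← Real.sqrt_sq (by positivity : 0 ≤ 2 * r₁ * r₂ * u * x)]
    congr 1; ring
  have S2 : √(r₁ * r₂ * (c₁ + r₁ - (c₁ + r₁ * (2 * u ^ 2 - 1))) *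
      (c₂ + r₂ - (c₂ + r₂ * (2 * x ^ 2 - 1)))) = 2 * r₁ * r₂ * v * y := by
    rw [← Real.sqrt_sq (by positivity : 0 ≤ 2 * r₁ * r₂ * v * y)]
    congr 1; rw [mul_pow, mul_pow _ v, huv, hxy]; ring
  have S3 : √(r₁ * r₂ * (c₁ + r₁ - (c₁ + r₁ * (2 * u ^ 2 - 1))) *
      (c₂ + r₂ * (2 * x ^ 2 - 1) - c₂ + r₂)) = 2 * r₁ * r₂ * v * x := by
    rw [← Real.sqrt_sq (by positivity : 0 ≤ 2 * r₁ * r₂ * v * x)]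
    congr 1; rw [mul_pow, mul_pow _ v, huv]; ring
  rw [S1, S2, S3]
  set f : ℝ → ℝ := fun t => (triQuantileCR c₁ r₁ (c₁ + r₁ * (2 * u ^ 2 - 1)) t -
    triQuantileCR c₂ r₂ (c₂ + r₂ * (2 * x ^ 2 - 1)) t) ^ 2 with hf
  have E1 : Set.EqOn f (fun t => (((c₁ - r₁) - (c₂ - r₂)) + (2 * r₁ * u - 2 * r₂ * x) * √t
      + 0 * √(1 - t)) ^ 2) (Set.uIcc 0 (u ^ 2)) := by
    intro t ht
    rw [Set.uIcc_of_le (by positivity)] at ht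
    simp only [hf]
    rw [tri_left _ _ _ _ hr₁ hu ht.2, tri_left _ _ _ _ hr₂ hx (ht.2.trans hux)]
    ring
  have E2 : Set.EqOn f (fun t => (((c₁ + r₁) - (c₂ - r₂)) + (- 2 * r₂ * x) * √t
      + (- 2 * r₁ * v) * √(1 - t)) ^ 2) (Set.uIcc (u ^ 2) (x ^ 2)) := by
    intro t ht
    rw [Set.uIcc_of_le hux] at ht
    simp only [hf]
    rw [tri_right _ _ _ _ _ hr₁ hu hv huv ht.1, tri_left _ _ _ _ hr₂ hx ht.2]
    ring
  have E3 : Set.EqOn f (fun t => (((c₁ + r₁) - (c₂ + r₂)) + 0 * √t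
      + (2 * r₂ * y - 2 * r₁ * v) * √(1 - t)) ^ 2) (Set.uIcc (x ^ 2) 1) := by
    intro t ht
    rw [Set.uIcc_of_le hx1] at ht
    simp only [hf]
    rw [tri_right _ _ _ _ _ hr₁ hu hv huv (hux.trans ht.1),
      tri_right _ _ _ _ _ hr₂ hx hy hxy ht.1]
    ring
  have I1 : IntervalIntegrable f volume 0 (u ^ 2) := by
    refine IntervalIntegrable.congr (fun t ht => (E1 (Set.uIoc_subset_uIcc ht)).symm) ?_
    apply Continuous.intervalIntegrable; fun_prop
  have I2 : IntervalIntegrable f volume (u ^ 2) (x ^ 2) := by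
    refine IntervalIntegrable.congr (fun t ht => (E2 (Set.uIoc_subset_uIcc ht)).symm) ?_
    apply Continuous.intervalIntegrable; fun_prop
  have I3 : IntervalIntegrable f volume (x ^ 2) 1 := by
    refine IntervalIntegrable.congr (fun t ht => (E3 (Set.uIoc_subset_uIcc ht)).symm) ?_
    apply Continuous.intervalIntegrable; fun_prop
  rw [← intervalIntegral.integral_add_adjacent_intervals (I1.trans I2) I3,
    ← intervalIntegral.integral_add_adjacent_intervals I1 I2,
    intervalIntegral.integral_congr E1, intervalIntegral.integral_congr E2,
    intervalIntegral.integral_congr E3, triF_integral _ _ _ _ _ le_rfl (by positivity) hu1,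
    triF_integral _ _ _ _ _ (by positivity) hux hx1,
    triF_integral _ _ _ _ _ (by positivity) hx1 le_rfl]
  simp only [triF, ← huv, ← hxy, Real.sqrt_sq hu, Real.sqrt_sq hv, Real.sqrt_sq hx,
    Real.sqrt_sq hy, Real.sqrt_zero, sub_self]
  generalize Real.arcsin (2 * u ^ 2 - 1) = α
  generalize Real.arcsin (2 * x ^ 2 - 1) = β
  clear_value f
  clear E1 E2 E3 I1 I2 I3 S1 S2 S3
  grind
end

section
/- Let c₁ be a real number, r₁ > 0, and m₁ a real number with c₁ − r₁ ≤ m₁ ≤ c₁ + r₁; let Ψ₁⁻¹ be the Triangular quantile function with center c₁, half-range r₁ and mode m₁, and let c₂ be a real number with Ψ₂⁻¹(t) = c₂ for all t ∈ [0,1] (the quantile function of the degenerate interval [c₂,c₂]). Then ∫₀¹ (Ψ₁⁻¹(t) − Ψ₂⁻¹(t))² dt = (c₁−c₂)² − (4/3)(m₁−c₁)² − (1/3)r₁² + (2/3)(m₁−c₁)(c₁−c₂) + (m₁−c₁+r₁)³/(4r₁) + (c₁+r₁−m₁)³/(4r₁). -/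
open MeasureTheory Real

lemma tri_aux (A k p u : ℝ) (hk : 0 ≤ k) (hp : 0 ≤ p) (hu : 0 ≤ u) (h : k * p = u ^ 2) :
    ∫ t in (0 : ℝ)..p, (A + Real.sqrt (k * t)) ^ 2 =
      A ^ 2 * p + 4 / 3 * A * p * u + u ^ 2 * p / 2 := by
  have e : ∫ t in (0 : ℝ)..p, (A + Real.sqrt (k * t)) ^ 2 =
      ∫ t in (0 : ℝ)..p, (A ^ 2 + (2 * A * Real.sqrt k) * t ^ (1 / 2 : ℝ) + k * t) := by
    apply intervalIntegral.integral_congr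
    intro t ht
    rw [Set.uIcc_of_le hp] at ht
    have h1 : Real.sqrt (k * t) = Real.sqrt k * Real.sqrt t := Real.sqrt_mul hk t
    have h2 := Real.sq_sqrt hk
    have h3 := Real.sq_sqrt ht.1
    simp only [h1, ← Real.sqrt_eq_rpow]
    linear_combination (Real.sqrt t) ^ 2 * h2 + k * h3
  have i1 : IntervalIntegrable (fun t : ℝ => t ^ (1 / 2 : ℝ)) volume 0 p :=
    intervalIntegral.intervalIntegrable_rpow' (by norm_num)
  have i2 : IntervalIntegrable (fun t : ℝ => k * t) volume 0 p :=
    (by fun_prop : Continuous (fun t : ℝ => k * t)).intervalIntegrable _ _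
  rw [e, intervalIntegral.integral_add (intervalIntegrable_const.add (i1.const_mul _)) i2,
    intervalIntegral.integral_add intervalIntegrable_const (i1.const_mul _),
    intervalIntegral.integral_const_mul, intervalIntegral.integral_const_mul,
    integral_rpow (Or.inl (by norm_num)), integral_id, intervalIntegral.integral_const]
  have h4 : p ^ ((1 / 2 : ℝ) + 1) = p * Real.sqrt p := by
    rw [Real.rpow_add_one' hp (by norm_num), ← Real.sqrt_eq_rpow, mul_comm]
  have h5 : Real.sqrt k * Real.sqrt p = u := by
    rw [← Real.sqrt_mul hk, h, Real.sqrt_sq hu]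
  rw [h4, Real.zero_rpow (by norm_num)]
  simp only [smul_eq_mul]
  linear_combination (4 / 3 * A * p) * h5 + p / 2 * h

theorem mallows_triangular_degenerate (c₁ r₁ m₁ c₂ : ℝ)
    (hr₁ : 0 < r₁) (hm₁l : c₁ - r₁ ≤ m₁) (hm₁u : m₁ ≤ c₁ + r₁) :
    ∫ t in (0 : ℝ)..1, (triQuantileCR c₁ r₁ m₁ t - c₂) ^ 2 =
      (c₁ - c₂) ^ 2 - (4 / 3) * (m₁ - c₁) ^ 2 - (1 / 3) * r₁ ^ 2 +
        (2 / 3) * (m₁ - c₁) * (c₁ - c₂) +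
        (m₁ - c₁ + r₁) ^ 3 / (4 * r₁) + (c₁ + r₁ - m₁) ^ 3 / (4 * r₁) := by
  set p : ℝ := (m₁ - c₁) / (2 * r₁) + 1 / 2 with hp
  have hp' : p = (m₁ - c₁ + r₁) / (2 * r₁) := by rw [hp]; field_simp
  have hq' : 1 - p = (c₁ + r₁ - m₁) / (2 * r₁) := by rw [hp]; field_simp; ring
  have hp0 : 0 ≤ p := by rw [hp']; exact div_nonneg (by linarith) (by linarith)
  have hq0 : 0 ≤ 1 - p := by rw [hq']; exact div_nonneg (by linarith) (by linarith)
  have c1 : Continuous (fun t : ℝ =>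
      ((c₁ - r₁ - c₂) + Real.sqrt (2 * r₁ * (m₁ - c₁ + r₁) * t)) ^ 2) := by fun_prop
  have c2 : Continuous (fun t : ℝ =>
      (-(c₁ + r₁ - c₂) + Real.sqrt (2 * r₁ * (c₁ + r₁ - m₁) * (1 - t))) ^ 2) := by fun_prop
  have E1 : Set.EqOn (fun t : ℝ =>
      ((c₁ - r₁ - c₂) + Real.sqrt (2 * r₁ * (m₁ - c₁ + r₁) * t)) ^ 2)
      (fun t => (triQuantileCR c₁ r₁ m₁ t - c₂) ^ 2) (Set.uIoc 0 p) := by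
    intro t ht
    rw [Set.uIoc_of_le hp0] at ht
    simp only [triQuantileCR]
    rw [if_pos ht.2]
    ring
  have E2 : Set.EqOn (fun t : ℝ =>
      (-(c₁ + r₁ - c₂) + Real.sqrt (2 * r₁ * (c₁ + r₁ - m₁) * (1 - t))) ^ 2)
      (fun t => (triQuantileCR c₁ r₁ m₁ t - c₂) ^ 2) (Set.uIoc p 1) := by
    intro t ht
    rw [Set.uIoc_of_le (by linarith)] at ht
    simp only [triQuantileCR]
    rw [if_neg (not_le.mpr ht.1)]
    ring
  have I1 := (c1.intervalIntegrable (μ := volume) 0 p).congr E1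
  have I2 := (c2.intervalIntegrable (μ := volume) p 1).congr E2
  rw [← intervalIntegral.integral_add_adjacent_intervals I1 I2,
    ← intervalIntegral.integral_congr_ae (Filter.Eventually.of_forall E1),
    ← intervalIntegral.integral_congr_ae (Filter.Eventually.of_forall E2),
    intervalIntegral.integral_comp_sub_left (fun t : ℝ =>
      (-(c₁ + r₁ - c₂) + Real.sqrt (2 * r₁ * (c₁ + r₁ - m₁) * t)) ^ 2) 1, sub_self,
    tri_aux _ _ p (m₁ - c₁ + r₁) (mul_nonneg (by linarith) (by linarith)) hp0 (by linarith)
      (by rw [hp']; field_simp),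
    tri_aux _ _ (1 - p) (c₁ + r₁ - m₁) (mul_nonneg (by linarith) (by linarith)) hq0 (by linarith)
      (by rw [hq']; field_simp), hq', hp']
  field_simp
  ring
end

section
/- Let c₁, c₂ be real numbers and r₁, r₂ ≥ 0, and for k = 1,2 let Ψ_k⁻¹ be the Symmetric Triangular quantile function with center c_k and half-range r_k, namely Ψ_k⁻¹(t) = c_k − r_k + r_k√(2t) for 0 ≤ t ≤ 1/2 and Ψ_k⁻¹(t) = c_k + r_k − r_k√(2(1−t)) for 1/2 < t ≤ 1. Then the squared Mallows distance ∫₀¹ (Ψ₁⁻¹(t) − Ψ₂⁻¹(t))² dt equals (c₁−c₂)² + (1/6)(r₁−r₂)². -/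
open MeasureTheory Real

/-- The Symmetric Triangular quantile function with center `c` and half-range `r`. -/
noncomputable def symTriQuantile (c r : ℝ) (t : ℝ) : ℝ :=
  if t ≤ 1 / 2 then c - r + r * Real.sqrt (2 * t)
  else c + r - r * Real.sqrt (2 * (1 - t))

theorem half_int_aux (a b : ℝ) :
    ∫ t in (0 : ℝ)..(1 / 2), (a + b * Real.sqrt (2 * t)) ^ 2 =
      a ^ 2 / 2 + 2 * a * b / 3 + b ^ 2 / 4 := by
  have hs : ∫ t in (0 : ℝ)..(1 / 2), Real.sqrt (2 * t) = 1 / 3 := by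
    rw [intervalIntegral.integral_comp_mul_left (fun u => Real.sqrt u) (two_ne_zero)]
    simp only [Real.sqrt_eq_rpow]
    rw [integral_rpow (by left; norm_num)]
    norm_num
  have e : ∫ t in (0 : ℝ)..(1 / 2), (a + b * Real.sqrt (2 * t)) ^ 2 =
      ∫ t in (0 : ℝ)..(1 / 2), ((a ^ 2 + (2 * a * b) * Real.sqrt (2 * t)) + (2 * b ^ 2) * t) := by
    apply intervalIntegral.integral_congr
    intro t ht
    rw [Set.uIcc_of_le (by norm_num)] at ht
    have := Real.sq_sqrt (show 0 ≤ 2 * t by linarith [ht.1])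
    simp only
    linear_combination b ^ 2 * this
  rw [e, intervalIntegral.integral_add, intervalIntegral.integral_add,
    intervalIntegral.integral_const_mul, intervalIntegral.integral_const_mul, hs, integral_id,
    intervalIntegral.integral_const]
  · simp only [smul_eq_mul]
    ring
  all_goals exact Continuous.intervalIntegrable (by fun_prop) _ _

theorem mallows_symmetric_triangular (c₁ c₂ r₁ r₂ : ℝ) (h₁ : 0 ≤ r₁) (h₂ : 0 ≤ r₂) :
    ∫ t in (0 : ℝ)..1, (symTriQuantile c₁ r₁ t - symTriQuantile c₂ r₂ t) ^ 2 =
      (c₁ - c₂) ^ 2 + (1 / 6) * (r₁ - r₂) ^ 2 := by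
  have e1 : Set.EqOn (fun t => (symTriQuantile c₁ r₁ t - symTriQuantile c₂ r₂ t) ^ 2)
      (fun t => ((c₁ - c₂ - (r₁ - r₂)) + (r₁ - r₂) * Real.sqrt (2 * t)) ^ 2)
      (Set.uIcc 0 (1 / 2)) := by
    intro t ht
    rw [Set.uIcc_of_le (by norm_num)] at ht
    simp only [symTriQuantile, if_pos ht.2]
    ring
  have e2 : Set.EqOn (fun t => (symTriQuantile c₁ r₁ t - symTriQuantile c₂ r₂ t) ^ 2)
      (fun t => ((c₁ - c₂ + (r₁ - r₂)) + (-(r₁ - r₂)) * Real.sqrt (2 * (1 - t))) ^ 2)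
      (Set.uIcc (1 / 2) 1) := by
    intro t ht
    rw [Set.uIcc_of_le (by norm_num)] at ht
    rcases eq_or_lt_of_le ht.1 with h | h
    · subst h
      norm_num [symTriQuantile]
      ring
    · simp only [symTriQuantile, if_neg (not_le.mpr h)]
      ring
  have i1 : IntervalIntegrable (fun t => (symTriQuantile c₁ r₁ t - symTriQuantile c₂ r₂ t) ^ 2)
      volume 0 (1 / 2) :=
    (ContinuousOn.congr (Continuous.continuousOn (by fun_prop)) e1).intervalIntegrable
  have i2 : IntervalIntegrable (fun t => (symTriQuantile c₁ r₁ t - symTriQuantile c₂ r₂ t) ^ 2)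
      volume (1 / 2) 1 :=
    (ContinuousOn.congr (Continuous.continuousOn (by fun_prop)) e2).intervalIntegrable
  rw [← intervalIntegral.integral_add_adjacent_intervals i1 i2,
    intervalIntegral.integral_congr e1, intervalIntegral.integral_congr e2, half_int_aux,
    intervalIntegral.integral_comp_sub_left
      (fun s => ((c₁ - c₂ + (r₁ - r₂)) + (-(r₁ - r₂)) * Real.sqrt (2 * s)) ^ 2) 1]
  rw [show (1 : ℝ) - 1 = 0 by norm_num, show (1 : ℝ) - 1 / 2 = 1 / 2 by norm_num, half_int_aux]
  ring
end
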